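/- If (d,(u,α)) ∈ F and (d',(u',α)) ∈ F are two elements of F with the same V*-component α, then d − d' ∈ A and u − u' = σ(d − d'). (This is the well-definedness argument for the bivector Π_X in Section 4.2 of the paper.) -/

import Mathlib

/-- The symmetric bilinear pairing on `E = 𝔻 × (V × V*)`:
`⟪(d₁,(u₁,α₁)),(d₂,(u₂,α₂))⟫ = ⟨d₁,d₂⟩ + (1/2)(α₁(u₂) + α₂(u₁))`. -/
noncomputable def pairE {D V : Type*} [AddCommGroup D] [Module ℝ D] [AddCommGroup V] [Module ℝ V]
    (B : LinearMap.BilinForm ℝ D) (p q : D × V × Module.Dual ℝ V) : ℝ :=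
  B p.1 q.1 + (1 / 2) * (p.2.2 q.2.1 + q.2.2 p.2.1)

theorem stmt
    {D V : Type*} [AddCommGroup D] [Module ℝ D] [FiniteDimensional ℝ D]
    [AddCommGroup V] [Module ℝ V] [FiniteDimensional ℝ V]
    (B : LinearMap.BilinForm ℝ D) (hBsymm : B.IsSymm) (hBnd : B.Nondegenerate)
    (A : Submodule ℝ D)
    -- `A = A^⊥` (A is Lagrangian in 𝔻)
    (hA : (A : Set D) = {d : D | ∀ a ∈ A, B d a = 0})
    (F : Submodule ℝ (D × V × Module.Dual ℝ V))
    -- `F = F^⊥` with respect to the pairing `pairE B` (F is Lagrangian in E)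
    (hF : (F : Set (D × V × Module.Dual ℝ V)) =
      {e : D × V × Module.Dual ℝ V | ∀ f ∈ F, pairE B e f = 0})
    -- (i) `F` intersects `{0} × (V × {0})` trivially
    (hFi : ∀ u : V, ((0 : D), u, (0 : Module.Dual ℝ V)) ∈ F → u = 0)
    -- (ii) the image of `F ∩ (𝔻 × (V × {0}))` under the projection `E → 𝔻` equals `A`
    (hFii : ∀ d : D, d ∈ A ↔ ∃ u : V, (d, u, (0 : Module.Dual ℝ V)) ∈ F)
    -- `σ : A → V` assigns to each `a ∈ A` the (unique) `u` with `(a,(u,0)) ∈ F`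
    (σ : A → V) (hσ : ∀ a : A, ((a : D), σ a, (0 : Module.Dual ℝ V)) ∈ F)
    :
    ∀ (d d' : D) (u u' : V) (α : Module.Dual ℝ V),
      (d, u, α) ∈ F → (d', u', α) ∈ F →
      ∃ h : d - d' ∈ A, u - u' = σ ⟨d - d', h⟩ := by
  intro d d' u u' α h h'
  have hdiff : (d - d', u - u', (0 : Module.Dual ℝ V)) ∈ F := by
    simpa using F.sub_mem h h'
  have hmem : d - d' ∈ A := (hFii _).2 ⟨_, hdiff⟩
  refine ⟨hmem, sub_eq_zero.1 (hFi _ ?_)⟩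
  simpa using F.sub_mem hdiff (hσ ⟨d - d', hmem⟩)
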